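/- Let H be a Hilbert space and A, B ∈ B(H) compact operators. Then for every n ≥ 1, aₙ(M_{A,B}) ≤ aₙ(M_{A,B}^{K(H)}) ≤ 6.75 · (s(A) ⊗ s(B))ₙ, where M_{A,B} : B(H) → B(H) and M_{A,B}^{K(H)} : K(H) → K(H) are the operators X ↦ A X B and K(H) denotes the compact operators on H. -/

import Mathlib

open scoped BigOperators

noncomputable section

/-- The space of complex null sequences `c₀`. -/
def c0 : Set (ℕ → ℂ) := {α | Filter.Tendsto α Filter.atTop (nhds 0)}

/-- `rearrSum α n` is the supremum of `∑_{i ∈ F} |α i|` over finite sets `F ⊆ ℕ` with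
`|F| = n`; for a null sequence it equals `α*₁ + ⋯ + α*ₙ` where `α*` is the decreasing
rearrangement of `(|α_n|)`. -/
def rearrSum (α : ℕ → ℂ) (n : ℕ) : ℝ :=
  sSup ((fun F : Finset ℕ => ∑ i ∈ F, ‖α i‖) '' {F | F.card = n})

/-- The decreasing rearrangement of a null sequence, 0-indexed:
`rearr α n = α*_{n+1}`. -/
def rearr (α : ℕ → ℂ) (n : ℕ) : ℝ := rearrSum α (n + 1) - rearrSum α n

/-- A Calkin space: a linear subspace of `c₀` containing every null sequence whose
decreasing rearrangement is dominated termwise by that of one of its members. -/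
def IsCalkinSpace (I : Set (ℕ → ℂ)) : Prop :=
  I ⊆ c0 ∧ (0 : ℕ → ℂ) ∈ I ∧
  (∀ α ∈ I, ∀ β ∈ I, α + β ∈ I) ∧
  (∀ (c : ℂ), ∀ α ∈ I, c • α ∈ I) ∧
  (∀ α ∈ I, ∀ β ∈ c0, (∀ n, rearr β n ≤ rearr α n) → β ∈ I)

/-- `tensorSum α β n` is the supremum of `∑_{(i,j) ∈ F} |α i| |β j|` over finite
`F ⊆ ℕ × ℕ` with `|F| = n`; it equals `(α⊗β)₁ + ⋯ + (α⊗β)ₙ`. -/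
def tensorSum (α β : ℕ → ℂ) (n : ℕ) : ℝ :=
  sSup ((fun F : Finset (ℕ × ℕ) => ∑ p ∈ F, ‖α p.1‖ * ‖β p.2‖) '' {F | F.card = n})

/-- The tensor sequence `α⊗β`: the decreasing rearrangement of the double sequence
`(|α_m β_n|)_{m,n}`, 0-indexed: `tensorSeq α β n = (α⊗β)_{n+1}`. -/
def tensorSeq (α β : ℕ → ℂ) (n : ℕ) : ℝ := tensorSum α β (n + 1) - tensorSum α β n

/-- Embedding of real sequences into complex sequences. -/
def toC (f : ℕ → ℝ) : ℕ → ℂ := fun n => (f n : ℂ)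

/-- The tensor product `𝔦⊗𝔧` of two Calkin spaces: the smallest Calkin space
containing `α⊗β` for all `α ∈ 𝔦`, `β ∈ 𝔧`. -/
def calkinTensor (I J : Set (ℕ → ℂ)) : Set (ℕ → ℂ) :=
  ⋂₀ {K | IsCalkinSpace K ∧ ∀ α ∈ I, ∀ β ∈ J, toC (tensorSeq α β) ∈ K}

/-- A Calkin space `𝔦` is stable if `𝔦⊗𝔦 = 𝔦`. -/
def IsStableCalkin (I : Set (ℕ → ℂ)) : Prop := IsCalkinSpace I ∧ calkinTensor I I = I

/-- The principal Calkin space `⟨α⟩` generated by `α`: the smallest Calkin space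
containing `α`. -/
def principalCalkin (α : ℕ → ℂ) : Set (ℕ → ℂ) := ⋂₀ {K | IsCalkinSpace K ∧ α ∈ K}

/-- `Kw ω α n = #{m : ω^{n+1} < α m ≤ ω^n}` (the sequence `α` being 0-indexed). -/
def Kw (ω : ℝ) (α : ℕ → ℝ) (n : ℕ) : ℕ :=
  Set.ncard {m : ℕ | ω ^ (n + 1) < α m ∧ α m ≤ ω ^ n}

/-- `K̃ₙ = Σ_{i=0}^n Kᵢ`. -/
def Ktil (ω : ℝ) (α : ℕ → ℝ) (n : ℕ) : ℕ := ∑ i ∈ Finset.range (n + 1), Kw ω α i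

/-- `Mₙ = Σ_{i+j=n} Kᵢ Kⱼ`. -/
def Mw (ω : ℝ) (α : ℕ → ℝ) (n : ℕ) : ℕ :=
  ∑ i ∈ Finset.range (n + 1), Kw ω α i * Kw ω α (n - i)

/-- `M̃ₙ = Σ_{i=0}^n Mᵢ`. -/
def Mtil (ω : ℝ) (α : ℕ → ℝ) (n : ℕ) : ℕ := ∑ i ∈ Finset.range (n + 1), Mw ω α i

/-- The `n`-th approximation number of `T` (1-indexed: `approxNum T n = aₙ(T)` is the
infimum of `‖T - F‖` over bounded operators `F` of rank `< n`).  For operators between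
Hilbert spaces this equals the `n`-th singular number. -/
def approxNum {X Y : Type*} [NormedAddCommGroup X] [NormedSpace ℂ X]
    [NormedAddCommGroup Y] [NormedSpace ℂ Y] (T : X →L[ℂ] Y) (n : ℕ) : ℝ :=
  sInf {c | ∃ F : X →L[ℂ] Y, LinearMap.rank (F : X →ₗ[ℂ] Y) < (n : Cardinal) ∧ c = ‖T - F‖}

/-- The `n`-th Kolmogorov number `dₙ(T)` (1-indexed). -/
def kolNum {X Y : Type*} [NormedAddCommGroup X] [NormedSpace ℂ X]
    [NormedAddCommGroup Y] [NormedSpace ℂ Y] (T : X →L[ℂ] Y) (n : ℕ) : ℝ :=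
  sInf {c | ∃ V : Submodule ℂ Y, Module.rank ℂ V < (n : Cardinal) ∧
    c = ⨆ x : {x : X // ‖x‖ ≤ 1}, ⨅ y : V, ‖T x.1 - (y : Y)‖}

/-- The `n`-th Hilbert number `hₙ(T)` (1-indexed): the supremum of `sₙ(A ∘ T ∘ B)` over
all Hilbert spaces `K`, `H'` and all contractions `B : K → X`, `A : Y → H'`. -/
def hilbertNum {X Y : Type u} [NormedAddCommGroup X] [NormedSpace ℂ X]
    [NormedAddCommGroup Y] [NormedSpace ℂ Y] (T : X →L[ℂ] Y) (n : ℕ) : ℝ :=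
  sSup {c | ∃ (K : Type u) (_ : NormedAddCommGroup K) (_ : InnerProductSpace ℂ K)
    (_ : CompleteSpace K) (H' : Type u) (_ : NormedAddCommGroup H')
    (_ : InnerProductSpace ℂ H') (_ : CompleteSpace H')
    (B : K →L[ℂ] X) (A : Y →L[ℂ] H'), ‖B‖ ≤ 1 ∧ ‖A‖ ≤ 1 ∧
    c = approxNum ((A.comp T).comp B) n}

/-- The sequence of singular numbers of an operator, 0-indexed:
`sSeq T n = s_{n+1}(T) = a_{n+1}(T)`. -/
def sSeq {X Y : Type*} [NormedAddCommGroup X] [NormedSpace ℂ X]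
    [NormedAddCommGroup Y] [NormedSpace ℂ Y] (T : X →L[ℂ] Y) : ℕ → ℝ :=
  fun n => approxNum T (n + 1)

/-- The multiplication operator `M_{a,b} : x ↦ a * x * b` on a normed algebra. -/
def Mop {A : Type*} [NonUnitalNormedRing A] [NormedSpace ℂ A] [IsScalarTower ℂ A A]
    [SMulCommClass ℂ A A] (a b : A) : A →L[ℂ] A :=
  (ContinuousLinearMap.mul ℂ A a).comp ((ContinuousLinearMap.mul ℂ A).flip b)

/-- The ideal `K(H)` of compact operators on `H`, as a submodule of `B(H)`. -/
def compactOps (H : Type*) [NormedAddCommGroup H] [InnerProductSpace ℂ H] :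
    Submodule ℂ (H →L[ℂ] H) where
  carrier := {T | IsCompactOperator ⇑T}
  add_mem' := fun h1 h2 => by simpa using h1.add h2
  zero_mem' := by simpa using isCompactOperator_zero
  smul_mem' := fun c T h => by simpa using h.smul c

open scoped InnerProductSpace in
theorem diag_exists {H : Type u} [NormedAddCommGroup H] [InnerProductSpace ℂ H]
    [CompleteSpace H] (A : H →L[ℂ] H) (hA : IsCompactOperator ⇑A) :
    ∃ (ι : Type u) (b : HilbertBasis ι ℂ H) (a : ι → ℝ), (∀ i, 0 ≤ a i) ∧
      ∀ y, HasSum (fun i => a i ^ 2 * ‖inner ℂ (b i) y‖ ^ 2) (‖A y‖ ^ 2) := by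
  classical
  set T : H →L[ℂ] H := (ContinuousLinearMap.adjoint A) ∘L A with hT
  have hTc : IsCompactOperator ⇑T := by
    have := hA.clm_comp (ContinuousLinearMap.adjoint A)
    exact this
  have hTi : ∀ x y, inner ℂ (T x) y = inner ℂ (A x) (A y) := by
    intro x y
    simp [hT, ContinuousLinearMap.adjoint_inner_left]
  have hTs : (T : H →ₗ[ℂ] H).IsSymmetric := by
    intro x y
    show inner ℂ (T x) y = inner ℂ x (T y)
    rw [hTi, ← inner_conj_symm x (T y), hTi, inner_conj_symm]
  have hbot := ContinuousLinearMap.orthogonalComplement_iSup_eigenspaces_eq_bot hTc hTs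
  have hfam := hTs.orthogonalFamily_eigenspaces
  have hcl : ∀ μ : ℂ, IsClosed ((Module.End.eigenspace (T : H →ₗ[ℂ] H) μ : Set H)) := by
    intro μ
    have : (Module.End.eigenspace (T : H →ₗ[ℂ] H) μ : Set H) = {x | T x = μ • x} := by
      ext x; simp
    rw [this]
    exact isClosed_eq T.continuous (continuous_const_smul μ)
  have hcs : ∀ μ : ℂ, CompleteSpace (Module.End.eigenspace (T : H →ₗ[ℂ] H) μ) :=
    fun μ => (hcl μ).completeSpace_coe
  choose w c hc using fun μ : ℂ =>
    exists_hilbertBasis ℂ (Module.End.eigenspace (T : H →ₗ[ℂ] H) μ)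
  have horth := hfam.orthonormal_sigma_orthonormal (v_family := fun μ => ⇑(c μ))
    (fun μ => (c μ).orthonormal)
  have hsp : (Submodule.span ℂ (Set.range fun a : Σ μ, w μ => ((c a.1 a.2 : 
      Module.End.eigenspace (T : H →ₗ[ℂ] H) a.1) : H)))ᗮ = ⊥ := by
    rw [eq_bot_iff, ← hbot]
    intro v hv
    rw [Submodule.mem_orthogonal] at hv
    rw [Submodule.mem_orthogonal]
    intro u hu
    refine Submodule.iSup_induction _ (motive := fun u => inner ℂ u v = 0) hu ?_ (by simp) ?_
    · intro μ x hx
      have h1 := ((c μ).hasSum_repr ⟨x, hx⟩).mapL 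
        (Module.End.eigenspace (T : H →ₗ[ℂ] H) μ).subtypeL
      have h2 := h1.mapL (innerSL ℂ v)
      have h3 : inner ℂ v x = 0 := by
        refine h2.unique ?_
        convert hasSum_zero using 1
        funext i
        have := hv _ (Submodule.subset_span ⟨⟨μ, i⟩, rfl⟩)
        simp only [map_smul, innerSL_apply_apply, Submodule.subtypeL_apply]
        rw [← inner_conj_symm, this]
        simp
      rw [← inner_conj_symm, h3]; simp
    · intro x y hx hy
      rw [inner_add_left, hx, hy, add_zero]
  let b := HilbertBasis.mkOfOrthogonalEqBot horth hsp
  have hb : ∀ i, b i = ((c i.1 i.2 : Module.End.eigenspace (T : H →ₗ[ℂ] H) i.1) : H) := by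
    intro i
    exact congrFun (HilbertBasis.coe_mkOfOrthogonalEqBot horth hsp) i
  have hTb : ∀ i, T (b i) = i.1 • b i := by
    intro i
    have := (c i.1 i.2).2
    rw [Module.End.mem_eigenspace_iff] at this
    rw [hb]; exact this
  have hmu : ∀ i, (starRingEnd ℂ) i.1 = ((‖A (b i)‖ ^ 2 : ℝ) : ℂ) := by
    intro i
    have h1 := hTi (b i) (b i)
    rw [hTb, inner_smul_left, inner_self_eq_norm_sq_to_K, inner_self_eq_norm_sq_to_K,
      b.orthonormal.1 i] at h1
    simpa using h1
  refine ⟨_, b, fun i => ‖A (b i)‖, fun i => norm_nonneg _, fun y => ?_⟩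
  have h := b.hasSum_inner_mul_inner (T y) y
  rw [hTi, inner_self_eq_norm_sq_to_K] at h
  have h2 : HasSum (fun i => ((‖A (b i)‖ ^ 2 * ‖inner ℂ (b i) y‖ ^ 2 : ℝ) : ℂ)) 
      ((‖A y‖ ^ 2 : ℝ) : ℂ) := by
    convert! h using 1
    · funext i
      have : inner ℂ (T y) (b i) = i.1 * inner ℂ y (b i) := by
        rw [← inner_smul_right, ← hTb]; exact hTs y (b i)
      have h4 : i.1 = ((‖A (b i)‖ ^ 2 : ℝ) : ℂ) := by
        rw [← Complex.conj_conj i.1, hmu, Complex.conj_ofReal]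
      rw [this, h4, mul_assoc, ← inner_conj_symm y (b i), mul_comm (starRingEnd ℂ _), 
        Complex.mul_conj, Complex.normSq_eq_norm_sq]
      push_cast; ring
    · simp
  exact_mod_cast h2

theorem hb_norm_sq {H : Type u} [NormedAddCommGroup H] [InnerProductSpace ℂ H]
    {ι : Type u} (b : HilbertBasis ι ℂ H) (y : H) :
    HasSum (fun i => ‖inner ℂ (b i) y‖ ^ 2) (‖y‖ ^ 2) := by
  have h := b.hasSum_inner_mul_inner y y
  rw [inner_self_eq_norm_sq_to_K] at h
  have h2 : HasSum (fun i => ((‖inner ℂ (b i) y‖ ^ 2 : ℝ) : ℂ)) ((‖y‖ ^ 2 : ℝ) : ℂ) := by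
    convert! h using 1
    · funext i
      rw [← inner_conj_symm y (b i), mul_comm (starRingEnd ℂ _), 
        Complex.mul_conj, Complex.normSq_eq_norm_sq]
    · simp
  exact_mod_cast h2

theorem diag_low {H : Type u} [NormedAddCommGroup H] [InnerProductSpace ℂ H]
    {A : H →L[ℂ] H} {ι : Type u} (b : HilbertBasis ι ℂ H) (a : ι → ℝ)
    (h : ∀ y, HasSum (fun i => a i ^ 2 * ‖inner ℂ (b i) y‖ ^ 2) (‖A y‖ ^ 2))
    {x : ℝ} (hx : 0 ≤ x) {y : H} (hy : ∀ i, inner ℂ (b i) y ≠ 0 → x ≤ a i) :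
    x * ‖y‖ ≤ ‖A y‖ := by
  have h1 : x ^ 2 * ‖y‖ ^ 2 ≤ ‖A y‖ ^ 2 := by
    refine hasSum_le (fun i => ?_) ((hb_norm_sq b y).mul_left (x ^ 2)) (h y)
    by_cases h0 : inner ℂ (b i) y = 0
    · simp [h0]
    · have := hy i h0
      gcongr
  rw [← mul_pow] at h1
  exact le_of_sq_le_sq h1 (norm_nonneg _)

theorem diag_norm {H : Type u} [NormedAddCommGroup H] [InnerProductSpace ℂ H]
    {A : H →L[ℂ] H} {ι : Type u} (b : HilbertBasis ι ℂ H) (a : ι → ℝ)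
    (ha : ∀ i, 0 ≤ a i)
    (h : ∀ y, HasSum (fun i => a i ^ 2 * ‖inner ℂ (b i) y‖ ^ 2) (‖A y‖ ^ 2)) (i : ι) :
    a i ≤ ‖A‖ := by
  classical
  have h1 := diag_low b a h (ha i) (y := b i) (fun j hj => by
    rw [orthonormal_iff_ite.mp b.orthonormal] at hj
    have : j = i := by by_contra hne; simp [hne] at hj
    rw [this])
  have h2 := A.le_opNorm (b i)
  rw [b.orthonormal.1 i] at h1 h2
  linarith

theorem diag_finite {H : Type u} [NormedAddCommGroup H] [InnerProductSpace ℂ H]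
    {A : H →L[ℂ] H} (hA : IsCompactOperator ⇑A) {ι : Type u} (b : HilbertBasis ι ℂ H) (a : ι → ℝ)
    (h : ∀ y, HasSum (fun i => a i ^ 2 * ‖inner ℂ (b i) y‖ ^ 2) (‖A y‖ ^ 2))
    {x : ℝ} (hx : 0 < x) : {i | x < a i}.Finite := by
  classical
  by_contra hinf
  have hinf : {i | x < a i}.Infinite := hinf
  let f := hinf.natEmbedding
  obtain ⟨K, hK, hsub⟩ := IsCompactOperator.image_closedBall_subset_compact 
    (𝕜₁ := ℂ) (f := (A : H →ₗ[ℂ] H)) hA 1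
  have hmem : ∀ n, A (b (f n)) ∈ K := fun n => hsub ⟨b (f n), by 
    simp [b.orthonormal.1], rfl⟩
  obtain ⟨z, -, φ, hφ, hz⟩ := hK.tendsto_subseq hmem
  have hcau := hz.cauchySeq
  rw [Metric.cauchySeq_iff] at hcau
  obtain ⟨N, hN⟩ := hcau x hx
  have h1 := hN N le_rfl (N+1) (by omega)
  have hne : (f (φ N)).1 ≠ (f (φ (N+1))).1 := by
    intro he
    have := hφ.injective (f.injective (Subtype.ext he))
    omega
  set i : ι := (f (φ N)).1 with hi
  set j : ι := (f (φ (N+1))).1 with hj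
  have hai : x < a i := (f (φ N)).2
  have haj : x < a j := (f (φ (N+1))).2
  have h2 := diag_low b a h hx.le (y := b i - b j) (fun k hk => by
    rw [inner_sub_right, orthonormal_iff_ite.mp b.orthonormal, 
      orthonormal_iff_ite.mp b.orthonormal] at hk
    by_cases h1 : k = i
    · rw [h1]; exact hai.le
    by_cases h2 : k = j
    · rw [h2]; exact haj.le
    simp [h1, h2] at hk)
  have h3 : 1 ≤ ‖b i - b j‖ := by
    have h4 := norm_inner_le_norm (𝕜 := ℂ) (b i) (b i - b j)
    rw [inner_sub_right, orthonormal_iff_ite.mp b.orthonormal, 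
      orthonormal_iff_ite.mp b.orthonormal] at h4
    simpa [hne, b.orthonormal.1] using h4
  have h5 : dist (A (b i)) (A (b j)) < x := h1
  rw [dist_eq_norm, ← map_sub] at h5
  nlinarith

theorem sSeq_ge {H : Type u} [NormedAddCommGroup H] [InnerProductSpace ℂ H]
    {A : H →L[ℂ] H} {ι : Type u} (b : HilbertBasis ι ℂ H) (a : ι → ℝ)
    (h : ∀ y, HasSum (fun i => a i ^ 2 * ‖inner ℂ (b i) y‖ ^ 2) (‖A y‖ ^ 2))
    {x : ℝ} (hx : 0 ≤ x) (I : Finset ι) (hI : ∀ i ∈ I, x ≤ a i) (k : ℕ) (hk : k < I.card) :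
    x ≤ sSeq A k := by
  classical
  unfold sSeq approxNum
  refine le_csInf ⟨_, 0, by simp, rfl⟩ ?_
  rintro _ ⟨F, hF, rfl⟩
  let g : (I → ℂ) →ₗ[ℂ] H := Fintype.linearCombination ℂ (fun i : I => b i)
  have hninj : ¬ Function.Injective ((F : H →ₗ[ℂ] H) ∘ₗ g) := by
    intro hinj
    have h1 := rank_range_of_injective _ hinj
    have h2 := LinearMap.rank_comp_le_left g (F : H →ₗ[ℂ] H)
    unfold LinearMap.rank at h2 hF
    rw [h1, rank_fun'] at h2
    have h3 := h2.trans_lt hF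
    simp at h3
    have : I.card ≤ k := by exact_mod_cast h3
    omega
  have hlin : LinearIndependent ℂ (fun i : I => b i) :=
    b.orthonormal.linearIndependent.comp _ Subtype.val_injective
  have hginj : Function.Injective g := by
    exact hlin.fintypeLinearCombination_injective
  obtain ⟨c, hc, hc0⟩ : ∃ c, F (g c) = 0 ∧ c ≠ 0 := by
    rw [← LinearMap.ker_eq_bot, Submodule.eq_bot_iff] at hninj
    push Not at hninj
    simpa using hninj
  have hy0 : g c ≠ 0 := fun h0 => hc0 (hginj (by rw [h0, map_zero]))
  have h1 := diag_low b a h hx (y := g c) (fun i hi => by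
    by_contra hlt
    apply hi
    have hiI : i ∉ I := fun hh => hlt (hI i hh)
    simp only [g, Fintype.linearCombination_apply, inner_sum, inner_smul_right]
    refine Finset.sum_eq_zero fun j _ => ?_
    rw [orthonormal_iff_ite.mp b.orthonormal]
    have : i ≠ j := fun hh => hiI (hh ▸ j.2)
    simp [this])
  have h2 := (A - F).le_opNorm (g c)
  rw [sub_apply, hc, sub_zero] at h2
  have hpos : 0 < ‖g c‖ := norm_pos_iff.mpr hy0
  exact le_of_mul_le_mul_right (h1.trans h2) hpos

theorem exists_inj {ι : Type u} (f : ι → ℝ) (I : Finset ι) :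
    ∃ k : ι → ℕ, Set.InjOn k I ∧ ∀ i ∈ I, k i < (I.filter (fun j => f i ≤ f j)).card := by
  classical
  induction I using Finset.induction_on_min_value f with
  | empty => exact ⟨fun _ => 0, by simp, by simp⟩
  | insert i s his hmin ih =>
    obtain ⟨k, hk, hk2⟩ := ih
    have hlt : ∀ j ∈ s, k j < s.card := fun j hj => 
      (hk2 j hj).trans_le (Finset.card_filter_le _ _)
    have hne : ∀ j ∈ s, j ≠ i := fun j hj he => his (he ▸ hj)
    refine ⟨Function.update k i s.card, ?_, ?_⟩
    · intro x hx y hy hxy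
      simp only [Finset.coe_insert, Set.mem_insert_iff, Finset.mem_coe] at hx hy
      rcases hx with rfl | hx <;> rcases hy with rfl | hy
      · rfl
      · have := hlt y hy
        simp [hne y hy] at hxy; omega
      · have := hlt x hx
        simp [hne x hx] at hxy; omega
      · simp [hne x hx, hne y hy] at hxy
        exact hk hx hy hxy
    · intro j hj
      rcases Finset.mem_insert.mp hj with rfl | hj
      · have : (insert j s).filter (fun l => f j ≤ f l) = insert j s := by
          apply Finset.filter_true_of_mem
          intro l hl
          rcases Finset.mem_insert.mp hl with rfl | hl
          · exact le_rfl
          · exact hmin l hl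
        rw [this, Finset.card_insert_of_notMem his]; simp
      · simp only [Function.update_of_ne (hne j hj)]
        exact (hk2 j hj).trans_le (Finset.card_le_card 
          (Finset.filter_subset_filter _ (Finset.subset_insert _ _)))

theorem tensor_count {α β : ℕ → ℂ} {a b : ℝ} (ha : ∀ i, ‖α i‖ ≤ a) (hb : ∀ i, ‖β i‖ ≤ b)
    {n : ℕ} {G : Finset (ℕ × ℕ)} {t : ℝ} (ht : tensorSeq α β n < t)
    (hG : ∀ p ∈ G, t ≤ ‖α p.1‖ * ‖β p.2‖) : G.card ≤ n := by
  classical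
  by_contra hlt
  push Not at hlt
  have hbdd : ∀ m, BddAbove 
      ((fun F : Finset (ℕ × ℕ) => ∑ p ∈ F, ‖α p.1‖ * ‖β p.2‖) '' {F | F.card = m}) := by
    intro m
    refine ⟨m * (a * b), ?_⟩
    rintro _ ⟨F, hF, rfl⟩
    have : ∑ p ∈ F, ‖α p.1‖ * ‖β p.2‖ ≤ ∑ p ∈ F, a * b := 
      Finset.sum_le_sum fun p _ => mul_le_mul (ha _) (hb _) (norm_nonneg _) 
        ((norm_nonneg _).trans (ha 0))
    have hF' : F.card = m := hF
    simpa [hF'] using this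
  have key : tensorSum α β n ≤ tensorSum α β (n+1) - t := by
    unfold tensorSum
    obtain ⟨F0, -, hF0⟩ := Finset.exists_subset_card_eq (s := G) (n := n) (by omega)
    refine csSup_le ⟨_, F0, hF0, rfl⟩ ?_
    rintro _ ⟨F, hF, rfl⟩
    have hF' : F.card = n := hF
    obtain ⟨p, hp, hpF⟩ := Finset.exists_mem_notMem_of_card_lt_card (s := F) (t := G) (by omega)
    have h1 := le_csSup (hbdd (n+1)) ⟨insert p F, by 
      show (insert p F).card = n + 1
      rw [Finset.card_insert_of_notMem hpF, hF'], rfl⟩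
    simp only [Finset.sum_insert hpF] at h1
    have := hG p hp
    simp only
    linarith
  unfold tensorSeq at ht
  linarith

theorem geo_sum (M : ℕ) (c : ℝ) (_hc : 0 ≤ c) : ∀ x : ℝ, 0 ≤ x →
    ∑ p ∈ Finset.range M, (if x * (1/2) ^ p ≤ c then (x * (1/2) ^ p) ^ 2 else 0) 
      ≤ 4 / 3 * c ^ 2 := by
  have aux : ∀ M : ℕ, ∀ x : ℝ, 
      ∑ p ∈ Finset.range M, (x * (1/2) ^ p) ^ 2 ≤ 4 / 3 * x ^ 2 := by
    intro M
    induction M with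
    | zero => intro x; simp; positivity
    | succ M ih =>
      intro x
      rw [Finset.sum_range_succ']
      have := ih (x / 2)
      have e : ∀ p : ℕ, x * (1/2) ^ (p+1) = x / 2 * (1/2) ^ p := fun p => by ring
      simp only [e]
      simp only [pow_zero, mul_one]
      nlinarith
  induction M with
  | zero => intro x _; simp; positivity
  | succ M ih =>
    intro x hx
    by_cases hxc : x ≤ c
    · refine le_trans (Finset.sum_le_sum (g := fun p => (x * (1/2) ^ p) ^ 2) ?_) 
        ((aux (M+1) x).trans (by gcongr))
      intro p _
      split_ifs
      · exact le_rfl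
      · positivity
    · rw [Finset.sum_range_succ']
      have := ih (x / 2) (by positivity)
      have e : ∀ p : ℕ, x * (1/2) ^ (p+1) = x / 2 * (1/2) ^ p := fun p => by ring
      simp only [e]
      simpa [hxc] using this

theorem approxNum_le {X Y : Type*} [NormedAddCommGroup X] [NormedSpace ℂ X]
    [NormedAddCommGroup Y] [NormedSpace ℂ Y] (T F : X →L[ℂ] Y) (n : ℕ)
    (hF : LinearMap.rank (F : X →ₗ[ℂ] Y) < (n : Cardinal)) : approxNum T n ≤ ‖T - F‖ := by
  refine csInf_le ⟨0, ?_⟩ ⟨F, hF, rfl⟩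
  rintro _ ⟨F, -, rfl⟩
  exact norm_nonneg _

theorem sSeq_nonneg {X Y : Type*} [NormedAddCommGroup X] [NormedSpace ℂ X]
    [NormedAddCommGroup Y] [NormedSpace ℂ Y] (T : X →L[ℂ] Y) (n : ℕ) : 0 ≤ sSeq T n := by
  refine Real.sInf_nonneg ?_
  rintro _ ⟨F, -, rfl⟩
  exact norm_nonneg _

theorem toC_sSeq_norm {X Y : Type*} [NormedAddCommGroup X] [NormedSpace ℂ X]
    [NormedAddCommGroup Y] [NormedSpace ℂ Y] (T : X →L[ℂ] Y) (n : ℕ) : 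
    ‖toC (sSeq T) n‖ = sSeq T n := by
  simp [toC, sSeq_nonneg]

theorem sSeq_le {X Y : Type*} [NormedAddCommGroup X] [NormedSpace ℂ X]
    [NormedAddCommGroup Y] [NormedSpace ℂ Y] (T : X →L[ℂ] Y) (n : ℕ) : sSeq T n ≤ ‖T‖ := by
  have := approxNum_le T 0 (n+1) (by simp)
  rw [sub_zero] at this
  exact this

theorem exists_proj {H : Type u} [NormedAddCommGroup H] [InnerProductSpace ℂ H]
    [CompleteSpace H] (B : H →L[ℂ] H) (hB : IsCompactOperator ⇑B) {ε : ℝ} (hε : 0 < ε) :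
    ∃ R : H →L[ℂ] H, ‖R‖ ≤ 1 ∧ (∀ X : H →L[ℂ] H, IsCompactOperator ⇑(X * R)) ∧
      ‖B - R * B‖ ≤ ε := by
  obtain ⟨K, hK, hsub⟩ := IsCompactOperator.image_closedBall_subset_compact 
    (𝕜₁ := ℂ) (f := (B : H →ₗ[ℂ] H)) hB 1
  obtain ⟨t, ht, hcov⟩ := Metric.totallyBounded_iff.mp hK.totallyBounded ε hε
  let U : Submodule ℂ H := Submodule.span ℂ t
  have : FiniteDimensional ℂ U := FiniteDimensional.span_of_finite ℂ ht
  have : ProperSpace U := FiniteDimensional.proper ℂ U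
  refine ⟨U.starProjection, Submodule.starProjection_norm_le U, ?_, ?_⟩
  · intro X
    have h1 : IsCompactOperator ⇑(X ∘L U.subtypeL) := 
      isCompactOperator_of_locallyCompactSpace_rng _
    exact h1.comp_clm U.orthogonalProjectionOnto
  · refine ContinuousLinearMap.opNorm_le_of_unit_norm (𝕜 := ℂ) hε.le ?_ 
    intro x hx
    have hm : B x ∈ K := hsub ⟨x, by simp [hx], rfl⟩
    obtain ⟨y, hy, hxy⟩ := Set.mem_iUnion₂.mp (hcov hm)
    have h2 := U.starProjection_minimal (B x)
    show ‖B x - U.starProjection (B x)‖ ≤ ε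
    rw [h2]
    refine (ciInf_le ⟨0, ?_⟩ (⟨y, Submodule.subset_span hy⟩ : U)).trans ?_
    · rintro _ ⟨z, rfl⟩
      exact norm_nonneg _
    · rw [← dist_eq_norm]; exact (Metric.mem_ball.mp hxy).le

theorem part1 {H : Type u} [NormedAddCommGroup H] [InnerProductSpace ℂ H]
    [CompleteSpace H]
    (A B : H →L[ℂ] H) (hB : IsCompactOperator ⇑B)
    (Φ' : compactOps H →L[ℂ] compactOps H)
    (hΦ' : ∀ X : compactOps H, (Φ' X : H →L[ℂ] H) = A * (X : H →L[ℂ] H) * B) (n : ℕ) :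
    approxNum (Mop A B) (n + 1) ≤ approxNum Φ' (n + 1) := by
  conv_rhs => unfold approxNum
  refine le_csInf ⟨_, 0, by simp, rfl⟩ ?_
  rintro _ ⟨F, hF, rfl⟩
  refine le_of_forall_pos_le_add fun δ hδ => ?_
  obtain ⟨R, hR1, hRc, hRB⟩ := exists_proj B hB (ε := δ / (‖A‖ + 1)) (by positivity)
  let J : (H →L[ℂ] H) →L[ℂ] compactOps H :=
    ((ContinuousLinearMap.mul ℂ (H →L[ℂ] H)).flip R).codRestrict (compactOps H) (fun X => hRc X)
  have hJ : ∀ X, ((J X : compactOps H) : H →L[ℂ] H) = X * R := fun X => rfl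
  have hJn : ∀ X, ‖J X‖ ≤ ‖X‖ := by
    intro X
    show ‖((J X : compactOps H) : H →L[ℂ] H)‖ ≤ ‖X‖
    rw [hJ]
    exact (norm_mul_le _ _).trans (mul_le_of_le_one_right (norm_nonneg _) hR1)
  refine (approxNum_le _ ((compactOps H).subtypeL ∘L (F ∘L J)) (n+1) ?_).trans ?_
  · refine lt_of_le_of_lt ?_ hF
    have r1 := LinearMap.rank_comp_le_left J.toLinearMap F.toLinearMap
    have r2 := LinearMap.rank_comp_le_right (F.toLinearMap ∘ₗ J.toLinearMap)
      (compactOps H).subtype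
    exact r2.trans r1
  · refine ContinuousLinearMap.opNorm_le_bound _ (by positivity) fun X => ?_
    have e : (Mop A B - (compactOps H).subtypeL ∘L (F ∘L J)) X = 
        A * X * (B - R * B) + (((Φ' - F) (J X) : compactOps H) : H →L[ℂ] H) := by
      have : (((Φ' - F) (J X) : compactOps H) : H →L[ℂ] H) = A * (X * R) * B - (F (J X) : compactOps H) := by
        rw [sub_apply, Submodule.coe_sub, hΦ', hJ]
      rw [this]
      show A * (X * B) - ((F (J X) : compactOps H) : H →L[ℂ] H) = _
      noncomm_ring
    rw [e]
    have h1 : ‖A * X * (B - R * B)‖ ≤ δ * ‖X‖ := by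
      calc _ ≤ ‖A‖ * ‖X‖ * (δ / (‖A‖ + 1)) := 
            (norm_mul_le _ _).trans (mul_le_mul (norm_mul_le _ _) hRB (norm_nonneg _) (by positivity))
        _ = (‖A‖ / (‖A‖ + 1)) * (δ * ‖X‖) := by ring
        _ ≤ 1 * (δ * ‖X‖) := by
            gcongr
            rw [div_le_one (by positivity)]; linarith
        _ = _ := one_mul _
    have h2 : ‖(((Φ' - F) (J X) : compactOps H) : H →L[ℂ] H)‖ ≤ ‖Φ' - F‖ * ‖X‖ :=
      ((Φ' - F).le_opNorm (J X)).trans (by gcongr; exact hJn X)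
    refine (norm_add_le _ _).trans ?_
    linarith

theorem part2_aux {H : Type u} [NormedAddCommGroup H] [InnerProductSpace ℂ H]
    [CompleteSpace H]
    (A B : H →L[ℂ] H) (hA : IsCompactOperator ⇑A) (hB : IsCompactOperator ⇑B)
    (Φ' : compactOps H →L[ℂ] compactOps H)
    (hΦ' : ∀ X : compactOps H, (Φ' X : H →L[ℂ] H) = A * (X : H →L[ℂ] H) * B) (n : ℕ)
    (l : ℝ) (hl : 0 < l) (hlt : tensorSeq (toC (sSeq A)) (toC (sSeq B)) n < l) :
    approxNum Φ' (n + 1) ≤ 6.75 * l := by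
  classical
  obtain ⟨ι, b, a, ha0, ha⟩ := diag_exists A hA
  obtain ⟨κ, c, t, ht0, ht⟩ := diag_exists B hB
  obtain ⟨α, hα⟩ : ∃ α : ℝ, α = ‖A‖ + 1 := ⟨_, rfl⟩
  have hα0 : 0 < α := by rw [hα]; positivity
  have haα : ∀ i, a i ≤ α := fun i => by
    have := diag_norm b a ha0 ha i
    linarith
  obtain ⟨N, hN⟩ : ∃ N : ℕ, (1/2 : ℝ) ^ N < l / (α * (‖B‖ + 1)) :=
    exists_pow_lt_of_lt_one (by positivity) (by norm_num)
  have hN' : ∀ j, α * (1/2) ^ N * t j ≤ l := by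
    intro j
    have h1 : t j ≤ ‖B‖ + 1 := by have := diag_norm c t ht0 ht j; linarith
    rw [lt_div_iff₀ (by positivity)] at hN
    calc α * (1/2) ^ N * t j ≤ α * (1/2) ^ N * (‖B‖ + 1) := by gcongr
      _ ≤ l := by linarith
  let p : ι → ℕ := fun i => Nat.findGreatest (fun p => a i ≤ α * (1/2) ^ p) N
  have hp1 : ∀ i, a i ≤ α * (1/2) ^ p i := fun i =>
    Nat.findGreatest_spec (P := fun p => a i ≤ α * (1/2) ^ p) (Nat.zero_le N) (by simpa using haα i)
  have hp2 : ∀ i, p i ≤ N := fun i => Nat.findGreatest_le N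
  have hp3 : ∀ i, p i < N → α * (1/2) ^ (p i + 1) < a i := fun i hi => by
    have := Nat.findGreatest_is_greatest (P := fun p => a i ≤ α * (1/2) ^ p) (n := N) 
      (k := p i + 1) (Nat.lt_succ_self _) hi
    exact not_le.mp this
  let I : Finset ι := (diag_finite hA b a ha (x := α * (1/2) ^ N) (by positivity)).toFinset
  let J : Finset κ := (diag_finite hB c t ht (x := l / α) (by positivity)).toFinset
  have hI : ∀ i, i ∈ I ↔ α * (1/2) ^ N < a i := fun i => by simp [I]
  have hJ : ∀ j, j ∈ J ↔ l / α < t j := fun j => by simp [J]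
  have hIp : ∀ i ∈ I, p i < N := fun i hi => by
    refine lt_of_le_of_ne (hp2 i) fun he => ?_
    have := hp1 i
    rw [he] at this
    exact absurd ((hI i).mp hi) (not_lt.mpr this)
  have hIp' : ∀ i, i ∉ I → p i = N := fun i hi => by
    by_contra hne
    have h1 : p i < N := lt_of_le_of_ne (hp2 i) hne
    have h2 := hp3 i h1
    rw [hI, not_lt] at hi
    have h3 : (1/2 : ℝ) ^ N ≤ (1/2) ^ (p i + 1) := 
      pow_le_pow_of_le_one (by norm_num) (by norm_num) h1
    nlinarith
  let Jp : ℕ → Finset κ := fun q => J.filter (fun j => l < α * (1/2) ^ (q+1) * t j)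
  have hJp : ∀ q j, j ∈ Jp q ↔ l < α * (1/2) ^ (q+1) * t j := by
    intro q j
    simp only [Jp, Finset.mem_filter, hJ]
    refine ⟨fun h => h.2, fun h => ⟨?_, h⟩⟩
    rw [div_lt_iff₀ hα0]
    have : (1/2 : ℝ) ^ (q+1) ≤ 1 := pow_le_one₀ (by norm_num) (by norm_num)
    have h2 : α * (1/2) ^ (q+1) * t j ≤ α * 1 * t j := by
      have := ht0 j
      gcongr
    linarith
  let S : Finset (ι × κ) := (I ×ˢ J).filter (fun q => l < α * (1/2) ^ (p q.1 + 1) * t q.2)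
  -- counting
  have hcard : S.card ≤ n := by
    obtain ⟨k, hk, hk2⟩ := exists_inj a I
    obtain ⟨m, hm, hm2⟩ := exists_inj t J
    have hSI : ∀ q ∈ S, q.1 ∈ I ∧ q.2 ∈ J ∧ l < α * (1/2) ^ (p q.1 + 1) * t q.2 := by
      intro q hq
      simp only [S, Finset.mem_filter, Finset.mem_product] at hq
      exact ⟨hq.1.1, hq.1.2, hq.2⟩
    have hinj : Set.InjOn (fun q : ι × κ => (k q.1, m q.2)) S := by
      intro x hx y hy hxy
      have h1 := hSI x hx
      have h2 := hSI y hy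
      simp only [Prod.mk.injEq] at hxy
      exact Prod.ext (hk h1.1 h2.1 hxy.1) (hm h1.2.1 h2.2.1 hxy.2)
    rw [← Finset.card_image_of_injOn hinj]
    refine tensor_count (a := ‖A‖) (b := ‖B‖) (fun i => by rw [toC_sSeq_norm]; exact sSeq_le A i)
      (fun i => by rw [toC_sSeq_norm]; exact sSeq_le B i) hlt ?_
    intro z hz
    obtain ⟨q, hq, rfl⟩ := Finset.mem_image.mp hz
    obtain ⟨h1, h2, h3⟩ := hSI q hq
    rw [toC_sSeq_norm, toC_sSeq_norm]
    have h4 : a q.1 ≤ sSeq A (k q.1) := sSeq_ge b a ha (ha0 _) _ 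
      (fun i hi => (Finset.mem_filter.mp hi).2) _ (hk2 _ h1)
    have h5 : t q.2 ≤ sSeq B (m q.2) := sSeq_ge c t ht (ht0 _) _ 
      (fun i hi => (Finset.mem_filter.mp hi).2) _ (hm2 _ h2)
    have h6 := hp3 q.1 (hIp _ h1)
    have h7 : a q.1 * t q.2 ≤ sSeq A (k q.1) * sSeq B (m q.2) :=
      mul_le_mul h4 h5 (ht0 _) (sSeq_nonneg _ _)
    have h8 : α * (1/2) ^ (p q.1 + 1) * t q.2 ≤ a q.1 * t q.2 := 
      mul_le_mul_of_nonneg_right h6.le (ht0 _)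
    linarith
  -- the finite rank operator
  let u : ι × κ → compactOps H := fun q => ⟨(innerSL ℂ (c q.2)).smulRight (A (b q.1)), by
    have h1 : IsCompactOperator ⇑(innerSL ℂ (c q.2)) := 
      isCompactOperator_of_locallyCompactSpace_dom _
    exact h1.clm_comp (ContinuousLinearMap.toSpanSingleton ℂ (A (b q.1)))⟩
  let φ : ι × κ → (compactOps H →L[ℂ] ℂ) := fun q => 
    (innerSL ℂ (b q.1)) ∘L ((ContinuousLinearMap.apply ℂ H (B (c q.2))) ∘L (compactOps H).subtypeL)
  let F : compactOps H →L[ℂ] compactOps H := ∑ q ∈ S, (φ q).smulRight (u q)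
  have hFX : ∀ X : compactOps H, F X = ∑ q ∈ S, φ q X • u q := by
    intro X
    simp [F]
  have hrank : LinearMap.rank (F : compactOps H →ₗ[ℂ] compactOps H) < ((n + 1 : ℕ) : Cardinal) := by
    have h1 : LinearMap.range (F : compactOps H →ₗ[ℂ] compactOps H) ≤ 
        Submodule.span ℂ ((S.image u : Finset _) : Set (compactOps H)) := by
      rintro _ ⟨X, rfl⟩
      show F X ∈ _
      rw [hFX]
      refine Submodule.sum_mem _ fun q hq => Submodule.smul_mem _ _ (Submodule.subset_span ?_)
      exact Finset.mem_coe.mpr (Finset.mem_image_of_mem u hq)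
    have h2 := (Submodule.rank_mono h1).trans (rank_span_finset_le (S.image u))
    refine lt_of_le_of_lt h2 ?_
    have h3 : (S.image u).card < n + 1 := 
      Nat.lt_succ_of_le (Finset.card_image_le.trans hcard)
    exact_mod_cast h3
  refine (approxNum_le Φ' F (n+1) hrank).trans ?_
  refine ContinuousLinearMap.opNorm_le_bound _ (by positivity) fun X => ?_
  show ‖(((Φ' - F) X : compactOps H) : H →L[ℂ] H)‖ ≤ _
  have hXn : ‖X‖ = ‖(X : H →L[ℂ] H)‖ := rfl
  refine ContinuousLinearMap.opNorm_le_bound _ (by positivity) fun v => ?_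
  let Q : ℕ → H := fun q => ∑ j ∈ Jp q, (inner ℂ (c j) v : ℂ) • c j
  let Y : H →L[ℂ] H := X
  let y : H := Y (B v) - ∑ i ∈ I, (inner ℂ (b i) (Y (B (Q (p i)))) : ℂ) • b i
  have hy : (((Φ' - F) X : compactOps H) : H →L[ℂ] H) v = A y := by
    rw [sub_apply, Submodule.coe_sub, hΦ', hFX, sub_apply]
    simp only [y, map_sub]
    congr 1
    rw [Submodule.coe_sum, sum_apply, map_sum]
    simp only [S, Finset.sum_filter, Finset.sum_product]
    refine Finset.sum_congr rfl fun i _ => ?_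
    rw [map_smul]
    simp only [Q, Jp, map_sum, inner_sum, Finset.sum_smul,
      Finset.sum_filter]
    refine Finset.sum_congr rfl fun j _ => ?_
    split_ifs
    · show (inner ℂ (b i) (Y (B (c j))) : ℂ) • ((inner ℂ (c j) v : ℂ) • A (b i)) = _
      rw [smul_smul, mul_comm, map_smul, map_smul, inner_smul_right]
    · simp
  rw [hy]
  have hQ : ∀ q j, (inner ℂ (c j) (v - Q q) : ℂ) = if j ∈ Jp q then 0 else inner ℂ (c j) v := by
    intro q j
    simp only [Q, inner_sub_right, inner_sum, inner_smul_right, 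
      orthonormal_iff_ite.mp c.orthonormal]
    split_ifs with h <;> simp [h]
  have hQN : Q N = 0 := by
    have : Jp N = ∅ := by
      ext j
      rw [hJp]
      simp only [Finset.notMem_empty, iff_false, not_lt]
      have := hN' j
      have h2 : 0 ≤ α * (1/2) ^ N * t j := mul_nonneg (by positivity) (ht0 j)
      rw [pow_succ]; linarith
    simp [Q, this]
  have hyi : ∀ i, (inner ℂ (b i) y : ℂ) = inner ℂ (b i) (Y (B (v - Q (p i)))) := by
    intro i
    simp only [y, inner_sub_right, inner_sum, inner_smul_right, map_sub,
      orthonormal_iff_ite.mp b.orthonormal]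
    by_cases h : i ∈ I
    · simp [h]
    · simp [h, hIp' i h, hQN]
  have h1 : ‖A y‖ ^ 2 ≤ ∑ q ∈ Finset.range (N+1), (α * (1/2) ^ q) ^ 2 * ‖Y (B (v - Q q))‖ ^ 2 := by
    refine hasSum_le (fun i => ?_) (ha y) (hasSum_sum (s := Finset.range (N+1)) fun q _ => 
      (hb_norm_sq b (Y (B (v - Q q)))).mul_left ((α * (1/2) ^ q) ^ 2))
    rw [hyi]
    refine le_trans ?_ (Finset.single_le_sum (s := Finset.range (N+1)) (f := fun q => 
      (α * (1/2) ^ q) ^ 2 * ‖(inner ℂ (b i) (Y (B (v - Q q))) : ℂ)‖ ^ 2) 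
      (fun q _ => by positivity) (Finset.mem_range.mpr (Nat.lt_succ_of_le (hp2 i))))
    have := hp1 i
    have := ha0 i
    gcongr
  have h2 : ∑ q ∈ Finset.range (N+1), (α * (1/2) ^ q) ^ 2 * ‖B (v - Q q)‖ ^ 2 
      ≤ (4 / 3 * (2 * l) ^ 2) * ‖v‖ ^ 2 := by
    refine hasSum_le (fun j => ?_) (hasSum_sum (s := Finset.range (N+1)) fun q _ => 
      (ht (v - Q q)).mul_left ((α * (1/2) ^ q) ^ 2)) ((hb_norm_sq c v).mul_left _)
    have hg := geo_sum (N+1) (2 * l) (by positivity) (α * t j) (mul_nonneg hα0.le (ht0 j))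
    refine le_trans (le_of_eq ?_) (mul_le_mul_of_nonneg_right hg (sq_nonneg _))
    rw [Finset.sum_mul]
    refine Finset.sum_congr rfl fun q _ => ?_
    rw [hQ]
    have hiff : j ∈ Jp q ↔ ¬ (α * t j * (1/2) ^ q ≤ 2 * l) := by
      rw [hJp, not_le, pow_succ]
      constructor <;> intro h <;> nlinarith
    by_cases h : α * t j * (1/2) ^ q ≤ 2 * l
    · have h' : j ∉ Jp q := fun hh => (hiff.mp hh) h
      rw [if_pos h, if_neg h']; ring
    · rw [if_neg h, if_pos (hiff.mpr h)]; simp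
  have h3 : ‖A y‖ ^ 2 ≤ (6.75 * l * ‖X‖ * ‖v‖) ^ 2 := by
    calc ‖A y‖ ^ 2 ≤ _ := h1
      _ ≤ ∑ q ∈ Finset.range (N+1), ‖X‖ ^ 2 * ((α * (1/2) ^ q) ^ 2 * ‖B (v - Q q)‖ ^ 2) := by
          refine Finset.sum_le_sum fun q _ => ?_
          have h4 : ‖Y (B (v - Q q))‖ ≤ ‖X‖ * ‖B (v - Q q)‖ := Y.le_opNorm _
          calc _ ≤ (α * (1/2) ^ q) ^ 2 * (‖X‖ * ‖B (v - Q q)‖) ^ 2 := by gcongr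
            _ = _ := by ring
      _ ≤ ‖X‖ ^ 2 * ((4 / 3 * (2 * l) ^ 2) * ‖v‖ ^ 2) := by
          rw [← Finset.mul_sum]
          gcongr
      _ = 16 / 3 * (l * ‖X‖ * ‖v‖) ^ 2 := by ring
      _ ≤ 6.75 ^ 2 * (l * ‖X‖ * ‖v‖) ^ 2 := by
          gcongr
          norm_num
      _ = _ := by ring
  exact le_of_sq_le_sq h3 (by positivity)

/-- Let `A, B` be compact operators on a Hilbert space `H`.  Then
`aₙ(M_{A,B}) ≤ aₙ(M_{A,B}^{K(H)}) ≤ 6.75 (s(A)⊗s(B))ₙ` for every `n ≥ 1`, where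
`M_{A,B} : B(H) → B(H)` and `M_{A,B}^{K(H)} : K(H) → K(H)` are `X ↦ A X B`. -/
theorem approxNum_Mop_le {H : Type u} [NormedAddCommGroup H] [InnerProductSpace ℂ H]
    [CompleteSpace H]
    (A B : H →L[ℂ] H) (hA : IsCompactOperator ⇑A) (hB : IsCompactOperator ⇑B)
    (Φ' : compactOps H →L[ℂ] compactOps H)
    (hΦ' : ∀ X : compactOps H, (Φ' X : H →L[ℂ] H) = A * (X : H →L[ℂ] H) * B) :
    ∀ n : ℕ,
      approxNum (Mop A B) (n + 1) ≤ approxNum Φ' (n + 1) ∧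
      approxNum Φ' (n + 1) ≤ 6.75 * tensorSeq (toC (sSeq A)) (toC (sSeq B)) n := by
  intro n
  refine ⟨part1 A B hB Φ' hΦ' n, ?_⟩
  have h0 : 0 ≤ tensorSeq (toC (sSeq A)) (toC (sSeq B)) n := by
    by_contra hneg
    push Not at hneg
    have := tensor_count (a := ‖A‖) (b := ‖B‖) (fun i => by rw [toC_sSeq_norm]; exact sSeq_le A i)
      (fun i => by rw [toC_sSeq_norm]; exact sSeq_le B i) hneg
      (G := (Finset.range (n+1)).product {0}) (fun p _ => by positivity)
    simp [Finset.product_eq_sprod] at this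
  refine le_of_forall_pos_le_add fun ε hε => ?_
  have := part2_aux A B hA hB Φ' hΦ' n
    (tensorSeq (toC (sSeq A)) (toC (sSeq B)) n + ε / 6.75) (by positivity)
    (lt_add_of_pos_right _ (by positivity))
  rw [mul_add, mul_div_cancel₀ _ (by norm_num)] at this
  exact this
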